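/- Fix a field $k$. Let $\mathcal C$ and $\mathcal D$ be $k$-linear locally presentable monoidal categories whose tensor products are $k$-bilinear and preserve colimits in each variable. Let $\mathcal M$ be a $k$-linear locally presentable $(\mathcal C,\mathcal D)$-bimodule category, i.e. a category with a left $\mathcal C$-module structure and a right $\mathcal D$-module structure, both $k$-bilinear, together with natural isomorphisms $(x\otimes m)\otimes y\cong x\otimes(m\otimes y)$ satisfying the usual two pentagon and two triangle compatibilities with the associativity and unit isomorphisms of the two actions. Let $\mathrm{Dist}\in\mathcal M$ be an object such that the functors $\mathrm{act}_{\mathcal C}\colon\mathcal C\to\mathcal M$, $x\mapsto x\otimes\mathrm{Dist}$, and $\mathrm{act}_{\mathcal D}\colon\mathcal D\to\mathcal M$, $y\mapsto\mathrm{Dist}\otimes y$, preserve colimits. Then $\mathrm{act}_{\mathcal D}$ has a right adjoint. Let $\mathrm{act}_{\mathcal D}^R$ be any right adjoint, with counit $\epsilon_m\colon\mathrm{Dist}\otimes\mathrm{act}_{\mathcal D}^R(m)\to m$, and let $$\phi_{m,y}\colon \mathrm{act}_{\mathcal D}^R(m)\otimes y\to\mathrm{act}_{\mathcal D}^R(m\otimes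 y)$$ be the map adjoint to $\mathrm{Dist}\otimes(\mathrm{act}_{\mathcal D}^R(m)\otimes y)\cong(\mathrm{Dist}\otimes\mathrm{act}_{\mathcal D}^R(m))\otimes y\xrightarrow{\epsilon_m\otimes\mathrm{id}_y}m\otimes y$. The maps $\phi_{m,y}$ make $\mathrm{act}_{\mathcal D}^R$ a lax $\mathcal D$-module functor. The functor $F=\mathrm{act}_{\mathcal D}^R\circ\mathrm{act}_{\mathcal C}\colon\mathcal C\to\mathcal D$ is $k$-linear, and it is a lax monoidal functor with unit map the composite $$\mathbf 1_{\mathcal D}\to\mathrm{act}_{\mathcal D}^R(\mathrm{act}_{\mathcal D}(\mathbf 1_{\mathcal D}))\cong\mathrm{act}_{\mathcal D}^R(\mathrm{act}_{\mathcal C}(\mathbf 1_{\mathcal C}))$$ of the unit of the adjunction with the isomorphism induced by $\mathrm{Dist}\otimes\mathbf 1_{\mathcal D}\cong\mathrm{Dist}\cong\mathbf 1_{\mathcal C}\otimes\mathrm{Dist}$, and with multiplication the composite $$\mathrm{act}_{\mathcal D}^R(x\otimes\mathrm{Dist})\otimes\mathrm{act}_{\mathcal D}^R(y\otimes\mathrm{Dist})\xrightarrow{\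 \phi\ }\mathrm{act}_{\mathcal D}^R\bigl((x\otimes\mathrm{Dist})\otimes\mathrm{act}_{\mathcal D}^R(y\otimes\mathrm{Dist})\bigr)\to\mathrm{act}_{\mathcal D}^R((x\otimes y)\otimes\mathrm{Dist}),$$ where the second map is $\mathrm{act}_{\mathcal D}^R$ applied to $\mathrm{id}_x\otimes\epsilon_{y\otimes\mathrm{Dist}}$, with the associativity isomorphisms of $\mathcal M$ inserted. -/

import Mathlib

open CategoryTheory Limits MonoidalCategory
open scoped MonoidalLeftAction MonoidalRightAction

universe w v u₁ u₂ u₃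

/-- A `(C, D)`-bimodule category: a category `M` with a left action of `C` and a right action of
`D` (in Mathlib's sense, with all their coherence laws) together with a natural middle
associativity isomorphism `(x ⊗ m) ⊗ y ≅ x ⊗ (m ⊗ y)`, subject to the two pentagons relating it
to the associativity isomorphisms of the two actions and the two triangles relating it to their
unit isomorphisms. -/
class BimoduleCategory (C : Type u₁) (D : Type u₂) (M : Type u₃)
    [Category.{v} C] [Category.{v} D] [Category.{v} M]
    [MonoidalCategory C] [MonoidalCategory D]
    [MonoidalLeftAction C M] [MonoidalRightAction D M] where
  /-- the middle associativity isomorphism -/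
  middle (x : C) (m : M) (y : D) : (x ⊙ₗ m) ⊙ᵣ y ≅ x ⊙ₗ (m ⊙ᵣ y)
  middle_naturality_left {x x' : C} (f : x ⟶ x') (m : M) (y : D) :
    (f ⊵ₗ m) ⊵ᵣ y ≫ (middle x' m y).hom = (middle x m y).hom ≫ f ⊵ₗ (m ⊙ᵣ y)
  middle_naturality_mid (x : C) {m m' : M} (g : m ⟶ m') (y : D) :
    (x ⊴ₗ g) ⊵ᵣ y ≫ (middle x m' y).hom = (middle x m y).hom ≫ x ⊴ₗ (g ⊵ᵣ y)
  middle_naturality_right (x : C) (m : M) {y y' : D} (h : y ⟶ y') :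
    (x ⊙ₗ m) ⊴ᵣ h ≫ (middle x m y').hom = (middle x m y).hom ≫ x ⊴ₗ (m ⊴ᵣ h)
  /-- the pentagon for `x`, `x'`, `m`, `y` -/
  pentagon_left (x x' : C) (m : M) (y : D) :
    (αₗ x x' m).hom ⊵ᵣ y ≫ (middle x (x' ⊙ₗ m) y).hom ≫ x ⊴ₗ (middle x' m y).hom =
      (middle (x ⊗ x') m y).hom ≫ (αₗ x x' (m ⊙ᵣ y)).hom
  /-- the pentagon for `x`, `m`, `y`, `y'` -/
  pentagon_right (x : C) (m : M) (y y' : D) :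
    (αᵣ (x ⊙ₗ m) y y').hom ≫ (middle x m y).hom ⊵ᵣ y' ≫ (middle x (m ⊙ᵣ y) y').hom =
      (middle x m (y ⊗ y')).hom ≫ x ⊴ₗ (αᵣ m y y').hom
  /-- the triangle for `𝟙_ C`, `m`, `y` -/
  triangle_left (m : M) (y : D) :
    (middle (𝟙_ C) m y).hom ≫ (λₗ (m ⊙ᵣ y)).hom = (λₗ m).hom ⊵ᵣ y
  /-- the triangle for `x`, `m`, `𝟙_ D` -/
  triangle_right (x : C) (m : M) :
    (middle x m (𝟙_ D)).hom ≫ x ⊴ₗ (ρᵣ m).hom = (ρᵣ (x ⊙ₗ m)).hom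

/-- The two actions of a bimodule category are `k`-linear in each variable. -/
class IsLinearBimoduleCategory (k : Type w) [Field k] (C : Type u₁) (D : Type u₂) (M : Type u₃)
    [Category.{v} C] [Category.{v} D] [Category.{v} M]
    [Preadditive C] [Preadditive D] [Preadditive M] [Linear k C] [Linear k D] [Linear k M]
    [MonoidalCategory C] [MonoidalCategory D]
    [MonoidalLeftAction C M] [MonoidalRightAction D M] : Prop where
  additive_left (x : C) : (MonoidalLeftAction.actionLeft M x).Additive
  linear_left (x : C) : (MonoidalLeftAction.actionLeft M x).Linear k
  additive_left' (m : M) : (MonoidalLeftAction.actionRight C m).Additive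
  linear_left' (m : M) : (MonoidalLeftAction.actionRight C m).Linear k
  additive_right (y : D) : (MonoidalRightAction.actionRight M y).Additive
  linear_right (y : D) : (MonoidalRightAction.actionRight M y).Linear k
  additive_right' (m : M) : (MonoidalRightAction.actionLeft D m).Additive
  linear_right' (m : M) : (MonoidalRightAction.actionLeft D m).Linear k

namespace BimoduleCategory

section

variable (C : Type u₁) (D : Type u₂) {M : Type u₃}
  [Category.{v} C] [Category.{v} D] [Category.{v} M]
  [MonoidalCategory C] [MonoidalCategory D]
  [MonoidalLeftAction C M] [MonoidalRightAction D M] (Dist : M)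

/-- The action functor `act_C : C ⥤ M`, `x ↦ x ⊗ Dist`. -/
abbrev actC : C ⥤ M := MonoidalLeftAction.actionRight C Dist

/-- The action functor `act_D : D ⥤ M`, `y ↦ Dist ⊗ y`. -/
abbrev actD : D ⥤ M := MonoidalRightAction.actionLeft D Dist

end

section

variable {C : Type u₁} {D : Type u₂} {M : Type u₃}
  [Category.{v} C] [Category.{v} D] [Category.{v} M]
  [MonoidalCategory C] [MonoidalCategory D]
  [MonoidalLeftAction C M] [MonoidalRightAction D M]
  {Dist : M} {aR : M ⥤ D} (adj : actD D Dist ⊣ aR)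

/-- The lax `D`-module structure map `aR(m) ⊗ y ⟶ aR(m ⊗ y)` of a right adjoint `aR` of
`act_D`: the transpose of
`Dist ⊗ (aR(m) ⊗ y) ≅ (Dist ⊗ aR(m)) ⊗ y ⟶ m ⊗ y`, the second map being the counit at `m`
tensored with `y`. -/
def laxModuleMap (m : M) (y : D) : aR.obj m ⊗ y ⟶ aR.obj (m ⊙ᵣ y) :=
  adj.homEquiv (aR.obj m ⊗ y) (m ⊙ᵣ y)
    ((αᵣ Dist (aR.obj m) y).hom ≫ adj.counit.app m ⊵ᵣ y)

variable (C) in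
/-- The unit map `𝟙_D ⟶ aR(Dist ⊗ 𝟙_D) ≅ aR(𝟙_C ⊗ Dist)`. -/
def unitMap : 𝟙_ D ⟶ (actC C Dist ⋙ aR).obj (𝟙_ C) :=
  adj.unit.app (𝟙_ D) ≫ aR.map ((ρᵣ Dist).hom ≫ (λₗ Dist).inv)

/-- The multiplication map `aR(x ⊗ Dist) ⊗ aR(y ⊗ Dist) ⟶ aR((x ⊗ y) ⊗ Dist)`: the lax
`D`-module structure map, followed by `aR` applied to
`(x ⊗ Dist) ⊗ aR(y ⊗ Dist) ≅ x ⊗ (Dist ⊗ aR(y ⊗ Dist)) ⟶ x ⊗ (y ⊗ Dist) ≅ (x ⊗ y) ⊗ Dist`,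
in which the middle map is `x` tensored with the counit at `y ⊗ Dist`. -/
def mulMap [BimoduleCategory C D M] (x y : C) :
    (actC C Dist ⋙ aR).obj x ⊗ (actC C Dist ⋙ aR).obj y ⟶ (actC C Dist ⋙ aR).obj (x ⊗ y) :=
  laxModuleMap adj (x ⊙ₗ Dist) (aR.obj (y ⊙ₗ Dist)) ≫
    aR.map ((middle x Dist (aR.obj (y ⊙ₗ Dist))).hom ≫
      x ⊴ₗ adj.counit.app (y ⊙ₗ Dist) ≫ (αₗ x y Dist).inv)

end

end BimoduleCategory

/-- A colimit-preserving functor out of a locally presentable category, with locally small target,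
has a right adjoint. -/
theorem isLeftAdjoint_of_preservesColimits_of_isLocallyPresentable
    {D : Type u₂} {M : Type u₃} [Category.{v} D] [Category.{v} M] [IsLocallyPresentable.{v} D]
    (F : D ⥤ M) [PreservesColimits F] : F.IsLeftAdjoint := by
  obtain ⟨κ, _, _⟩ := IsLocallyPresentable.exists_cardinal.{v} D
  obtain ⟨P, _, hP⟩ := HasCardinalFilteredGenerator.exists_small_generator D κ
  suffices h : SolutionSetCondition.{v} F.op by
    have : PreservesLimits F.op := preservesLimits_op F
    have := isRightAdjoint_of_preservesLimits_of_solutionSetCondition F.op h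
    exact ⟨_, ⟨(Adjunction.ofIsRightAdjoint F.op).unop⟩⟩
  intro m
  -- the weakly terminal object over `m` is the colimit of all generators over `m`
  let K := CostructuredArrow (P.ι ⋙ F) m.unop
  let G : K ⥤ D := CostructuredArrow.proj (P.ι ⋙ F) m.unop ⋙ P.ι
  have : HasColimitsOfShape K D :=
    hasColimitsOfShape_of_equivalence (equivSmallModel.{v} K).symm
  have : PreservesColimitsOfShape K F :=
    preservesColimitsOfShape_of_equiv (equivSmallModel.{v} K).symm F
  let c : Cocone (G ⋙ F) :=
    { pt := m.unop
      ι := { app := fun j => j.hom, naturality := fun i j f => (CostructuredArrow.w f).trans (Category.comp_id _).symm } }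
  have hT := isColimitOfPreserves F (colimit.isColimit G)
  refine ⟨PUnit, fun _ => .op (colimit G), fun _ => (hT.desc c).op, fun X h => ⟨⟨⟩, ?_⟩⟩
  obtain ⟨J, _, _, ⟨p⟩⟩ := hP.exists_colimitsOfShape X.unop
  let obj (j : J) : K :=
    CostructuredArrow.mk (Y := (⟨p.diag.obj j, p.prop_diag_obj j⟩ : P.FullSubcategory))
      (F.map (p.ι.app j) ≫ h.unop)
  let map {i j : J} (f : i ⟶ j) : obj i ⟶ obj j :=
    CostructuredArrow.homMk (ObjectProperty.homMk (p.diag.map f)) (by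
      have h₀ : p.diag.map f ≫ p.ι.app j = p.ι.app i :=
        (p.ι.naturality f).trans (Category.comp_id _)
      change F.map (p.diag.map f) ≫ F.map (p.ι.app j) ≫ h.unop = F.map (p.ι.app i) ≫ h.unop
      rw [← Functor.map_comp_assoc, h₀])
  let s : Cocone p.diag :=
    { pt := colimit G
      ι :=
        { app := fun j => colimit.ι G (obj j)
          naturality := fun i j f =>
            (colimit.w G (map f)).trans (Category.comp_id _).symm } }
  refine ⟨(p.isColimit.desc s).op, ?_⟩
  apply Quiver.Hom.unop_inj
  refine (isColimitOfPreserves F p.isColimit).hom_ext fun j => ?_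
  have h₁ : p.ι.app j ≫ p.isColimit.desc s = colimit.ι G (obj j) := p.isColimit.fac s j
  have h₂ : F.map (colimit.ι G (obj j)) ≫ hT.desc c = F.map (p.ι.app j) ≫ h.unop :=
    hT.fac c (obj j)
  change F.map (p.ι.app j) ≫ F.map (p.isColimit.desc s) ≫ hT.desc c = F.map (p.ι.app j) ≫ h.unop
  rw [← Functor.map_comp_assoc, h₁]
  exact h₂

namespace BimoduleCategory

section Transpose

variable {D : Type u₂} {M : Type u₃} [Category.{v} D] [Category.{v} M]
  [MonoidalCategory D] [MonoidalRightAction D M]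
  {Dist : M} {aR : M ⥤ D} (adj : actD D Dist ⊣ aR)

/-- The counit `Dist ⊗ aR(m) ⟶ m`, with its source in the form `Dist ⊙ᵣ aR.obj m`. -/
def evaluation (m : M) : Dist ⊙ᵣ aR.obj m ⟶ m := adj.counit.app m

/-- The map `Dist ⊗ d ⟶ m` adjoint to `d ⟶ aR(m)`. -/
def transpose {d : D} {m : M} (g : d ⟶ aR.obj m) : Dist ⊙ᵣ d ⟶ m :=
  Dist ⊴ᵣ g ≫ evaluation adj m

theorem transpose_injective {d : D} {m : M} {g h : d ⟶ aR.obj m}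
    (e : transpose adj g = transpose adj h) : g = h :=
  (adj.homEquiv d m).symm.injective (by
    rw [adj.homEquiv_counit, adj.homEquiv_counit]; exact e)

theorem transpose_homEquiv {d : D} {m : M} (f : Dist ⊙ᵣ d ⟶ m) :
    transpose adj (adj.homEquiv d m f) = f :=
  (adj.homEquiv_counit _ _ _).symm.trans ((adj.homEquiv d m).symm_apply_apply f)

theorem transpose_comp {d d' : D} {m : M} (f : d ⟶ d') (g : d' ⟶ aR.obj m) :
    transpose adj (f ≫ g) = Dist ⊴ᵣ f ≫ transpose adj g := by
  simp [transpose]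

theorem transpose_map {m m' : M} (f : m ⟶ m') :
    transpose adj (aR.map f) = evaluation adj m ≫ f :=
  adj.counit.naturality f

theorem transpose_comp_map {d : D} {m m' : M} (g : d ⟶ aR.obj m) (f : m ⟶ m') :
    transpose adj (g ≫ aR.map f) = transpose adj g ≫ f := by
  rw [transpose_comp, transpose_map, transpose, Category.assoc]

theorem transpose_unit (d : D) :
    transpose (m := Dist ⊙ᵣ d) adj (adj.unit.app d) = 𝟙 (Dist ⊙ᵣ d) :=
  adj.left_triangle_components d

theorem transpose_laxModuleMap (m : M) (y : D) :
    transpose adj (laxModuleMap adj m y) =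
      (αᵣ Dist (aR.obj m) y).hom ≫ evaluation adj m ⊵ᵣ y :=
  transpose_homEquiv adj _

theorem transpose_whiskerRight_laxModuleMap {d : D} {m : M} (g : d ⟶ aR.obj m) (y : D) :
    transpose adj (g ▷ y ≫ laxModuleMap adj m y) =
      (αᵣ Dist d y).hom ≫ transpose adj g ⊵ᵣ y := by
  rw [transpose_comp, transpose_laxModuleMap]
  simp [transpose]

theorem transpose_whiskerLeft_laxModuleMap (m : M) {y y' : D} (g : y ⟶ y') :
    transpose adj (aR.obj m ◁ g ≫ laxModuleMap adj m y') =
      (αᵣ Dist (aR.obj m) y).hom ≫ evaluation adj m ⊵ᵣ y ≫ m ⊴ᵣ g := by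
  rw [transpose_comp, transpose_laxModuleMap, MonoidalRightAction.whiskerRight_actionHomLeft,
    ← MonoidalRightAction.action_exchange]
  simp only [Category.assoc, Iso.inv_hom_id_assoc]

theorem laxModuleMap_naturality_right (m : M) {y y' : D} (f : y ⟶ y') :
    aR.obj m ◁ f ≫ laxModuleMap adj m y' = laxModuleMap adj m y ≫ aR.map (m ⊴ᵣ f) :=
  transpose_injective adj (by
    rw [transpose_whiskerLeft_laxModuleMap, transpose_comp_map, transpose_laxModuleMap,
      Category.assoc])

theorem laxModuleMap_naturality_left {m m' : M} (f : m ⟶ m') (y : D) :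
    aR.map f ▷ y ≫ laxModuleMap adj m' y = laxModuleMap adj m y ≫ aR.map (f ⊵ᵣ y) :=
  transpose_injective adj (by
    rw [transpose_whiskerRight_laxModuleMap, transpose_comp_map, transpose_laxModuleMap,
      transpose_map, Category.assoc, MonoidalRightAction.comp_actionHomLeft])

theorem laxModuleMap_associativity (m : M) (y y' : D) :
    laxModuleMap adj m (y ⊗ y') ≫ aR.map (αᵣ m y y').hom =
      (α_ (aR.obj m) y y').inv ≫ laxModuleMap adj m y ▷ y' ≫ laxModuleMap adj (m ⊙ᵣ y) y' :=
  transpose_injective adj (by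
    have h := MonoidalRightAction.actionHom_associator (aR.obj m) y y' Dist
    rw [transpose_comp_map, transpose_laxModuleMap, transpose_comp,
      transpose_whiskerRight_laxModuleMap, transpose_laxModuleMap,
      MonoidalRightAction.comp_actionHomLeft, ← reassoc_of% h,
      MonoidalRightAction.actionHomRight_inv_hom_assoc]
    simp only [MonoidalRightAction.actionHomLeft_tensor, Category.assoc, Iso.inv_hom_id,
      Category.comp_id])

theorem laxModuleMap_unitality (m : M) :
    (ρ_ (aR.obj m)).hom = laxModuleMap adj m (𝟙_ D) ≫ aR.map (ρᵣ m).hom :=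
  transpose_injective adj (by
    rw [transpose_comp_map, transpose_laxModuleMap]
    simp [transpose])

/-- A right adjoint of `act_D` is a lax `D`-module functor. -/
@[reducible]
def laxRightLinear : aR.LaxRightLinear D where
  μᵣ m y := laxModuleMap adj m y
  μᵣ_naturality_right m _ _ f := laxModuleMap_naturality_right adj m f
  μᵣ_naturality_left f y := laxModuleMap_naturality_left adj f y
  μᵣ_associativity m y y' := laxModuleMap_associativity adj m y y'
  μᵣ_unitality m := laxModuleMap_unitality adj m

end Transpose

section LaxMonoidal

variable {C : Type u₁} {D : Type u₂} {M : Type u₃}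
  [Category.{v} C] [Category.{v} D] [Category.{v} M]
  [MonoidalCategory C] [MonoidalCategory D]
  [MonoidalLeftAction C M] [MonoidalRightAction D M]
  {Dist : M} {aR : M ⥤ D} (adj : actD D Dist ⊣ aR)

variable (C) in
/-- `unitMap` with its target in the form `aR.obj (𝟙_ C ⊙ₗ Dist)`. -/
def unitHom : 𝟙_ D ⟶ aR.obj (𝟙_ C ⊙ₗ Dist) := unitMap C adj

variable (C) in
theorem transpose_unitHom :
    transpose adj (unitHom C adj) = (ρᵣ Dist).hom ≫ (λₗ[C] Dist).inv := by
  refine (transpose_comp_map (m := Dist ⊙ᵣ 𝟙_ D) adj (adj.unit.app (𝟙_ D)) _).trans ?_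
  rw [transpose_unit]
  exact Category.id_comp _

variable [BimoduleCategory C D M]

/-- `mulMap` with its source and target written through the action. -/
def mulHom (x y : C) :
    aR.obj (x ⊙ₗ Dist) ⊗ aR.obj (y ⊙ₗ Dist) ⟶ aR.obj ((x ⊗ y) ⊙ₗ Dist) := mulMap adj x y

theorem mulHom_eq (x y : C) :
    mulHom adj x y = laxModuleMap adj (x ⊙ₗ Dist) (aR.obj (y ⊙ₗ Dist)) ≫
      aR.map ((middle x Dist (aR.obj (y ⊙ₗ Dist))).hom ≫
        x ⊴ₗ evaluation adj (y ⊙ₗ Dist) ≫ (αₗ x y Dist).inv) := rfl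

theorem transpose_mulHom (x y : C) :
    transpose adj (mulHom adj x y) =
      (αᵣ Dist _ _).hom ≫ evaluation adj (x ⊙ₗ Dist) ⊵ᵣ _ ≫ (middle x Dist _).hom ≫
        x ⊴ₗ evaluation adj (y ⊙ₗ Dist) ≫ (αₗ x y Dist).inv := by
  rw [mulHom_eq, transpose_comp_map, transpose_laxModuleMap]
  simp only [Category.assoc]

theorem transpose_whiskerRight_mulHom {d : D} {x : C} (g : d ⟶ aR.obj (x ⊙ₗ Dist)) (y : C) :
    transpose adj (g ▷ aR.obj (y ⊙ₗ Dist) ≫ mulHom adj x y) =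
      (αᵣ Dist d _).hom ≫ transpose adj g ⊵ᵣ _ ≫ (middle x Dist _).hom ≫
        x ⊴ₗ evaluation adj (y ⊙ₗ Dist) ≫ (αₗ x y Dist).inv := by
  rw [mulHom_eq, ← Category.assoc, transpose_comp_map, transpose_whiskerRight_laxModuleMap]
  simp only [Category.assoc]

theorem transpose_whiskerLeft_mulHom (x : C) {d : D} {y : C} (g : d ⟶ aR.obj (y ⊙ₗ Dist)) :
    transpose adj (aR.obj (x ⊙ₗ Dist) ◁ g ≫ mulHom adj x y) =
      (αᵣ Dist _ d).hom ≫ evaluation adj (x ⊙ₗ Dist) ⊵ᵣ d ≫ (middle x Dist d).hom ≫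
        x ⊴ₗ transpose adj g ≫ (αₗ x y Dist).inv := by
  have h := middle_naturality_right x Dist g
  rw [mulHom_eq, ← Category.assoc, transpose_comp_map, transpose_whiskerLeft_laxModuleMap]
  simp only [Category.assoc, transpose, MonoidalLeftAction.actionHomRight_comp]
  rw [reassoc_of% h]

theorem mulHom_naturality_left {x x' : C} (f : x ⟶ x') (y : C) :
    aR.map (f ⊵ₗ Dist) ▷ aR.obj (y ⊙ₗ Dist) ≫ mulHom adj x' y =
      mulHom adj x y ≫ aR.map ((f ▷ y) ⊵ₗ Dist) :=
  transpose_injective adj (by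
    have h := middle_naturality_left f Dist (aR.obj (y ⊙ₗ Dist))
    have h' := MonoidalLeftAction.action_exchange f (evaluation adj (y ⊙ₗ Dist))
    rw [transpose_whiskerRight_mulHom, transpose_comp_map, transpose_mulHom, transpose_map,
      MonoidalRightAction.comp_actionHomLeft, Category.assoc, reassoc_of% h, ← reassoc_of% h',
      MonoidalLeftAction.whiskerRight_actionHomLeft]
    simp only [Category.assoc, Iso.inv_hom_id_assoc])

theorem mulHom_naturality_right (x : C) {y y' : C} (f : y ⟶ y') :
    aR.obj (x ⊙ₗ Dist) ◁ aR.map (f ⊵ₗ Dist) ≫ mulHom adj x y' =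
      mulHom adj x y ≫ aR.map ((x ◁ f) ⊵ₗ Dist) :=
  transpose_injective adj (by
    rw [transpose_whiskerLeft_mulHom, transpose_comp_map, transpose_mulHom, transpose_map]
    simp only [MonoidalLeftAction.actionHomRight_comp,
      MonoidalLeftAction.whiskerLeft_actionHomLeft, Category.assoc, Iso.inv_hom_id_assoc])

theorem mulHom_associativity (x y z : C) :
    mulHom adj x y ▷ aR.obj (z ⊙ₗ Dist) ≫ mulHom adj (x ⊗ y) z ≫
        aR.map ((α_ x y z).hom ⊵ₗ Dist) =
      (α_ _ _ _).hom ≫ aR.obj (x ⊙ₗ Dist) ◁ mulHom adj y z ≫ mulHom adj x (y ⊗ z) :=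
  transpose_injective adj (by
    rw [← Category.assoc, transpose_comp_map, transpose_whiskerRight_mulHom, transpose_mulHom,
      transpose_comp, transpose_whiskerLeft_mulHom, transpose_mulHom]
    have hα := MonoidalRightAction.actionHom_associator
      (aR.obj (x ⊙ₗ Dist)) (aR.obj (y ⊙ₗ Dist)) (aR.obj (z ⊙ₗ Dist)) Dist
    have hm := middle_naturality_mid x (evaluation adj (y ⊙ₗ Dist)) (aR.obj (z ⊙ₗ Dist))
    have hr := pentagon_right x Dist (aR.obj (y ⊙ₗ Dist)) (aR.obj (z ⊙ₗ Dist))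
    have hl : (αₗ x y Dist).inv ⊵ᵣ aR.obj (z ⊙ₗ Dist) ≫
          (middle (x ⊗ y) Dist (aR.obj (z ⊙ₗ Dist))).hom =
        (middle x (y ⊙ₗ Dist) _).hom ≫ x ⊴ₗ (middle y Dist _).hom ≫ (αₗ x y _).inv := by
      have := pentagon_left x y Dist (aR.obj (z ⊙ₗ Dist))
      rw [← cancel_mono (αₗ x y _).hom, Category.assoc, ← this]
      simp only [MonoidalRightAction.inv_hom_actionHomLeft_assoc, Category.assoc, Iso.inv_hom_id,
        Category.comp_id]
    have ha : (αₗ x y (z ⊙ₗ Dist)).inv ≫ (αₗ (x ⊗ y) z Dist).inv ≫ (α_ x y z).hom ⊵ₗ Dist =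
        x ⊴ₗ (αₗ y z Dist).inv ≫ (αₗ x (y ⊗ z) Dist).inv := by
      have := MonoidalLeftAction.associator_actionHom x y z Dist
      rw [Iso.inv_comp_eq, Iso.inv_comp_eq, ← reassoc_of% this]
      simp only [MonoidalLeftAction.actionHomRight_hom_inv_assoc, Iso.hom_inv_id,
        Category.comp_id]
    simp only [MonoidalRightAction.comp_actionHomLeft, MonoidalLeftAction.actionHomRight_comp,
      MonoidalLeftAction.tensor_actionHomRight, MonoidalRightAction.actionHomLeft_tensor,
      Category.assoc]
    rw [reassoc_of% hl, Iso.inv_hom_id_assoc, ha, reassoc_of% hm, ← reassoc_of% hr,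
      ← reassoc_of% hα, Iso.inv_hom_id_assoc])

theorem mulHom_left_unitality (x : C) :
    (λ_ (aR.obj (x ⊙ₗ Dist))).hom =
      unitHom C adj ▷ aR.obj (x ⊙ₗ Dist) ≫ mulHom adj (𝟙_ C) x ≫
        aR.map ((λ_ x).hom ⊵ₗ Dist) :=
  transpose_injective adj (by
    have h := triangle_left (C := C) Dist (aR.obj (x ⊙ₗ Dist))
    rw [← Category.assoc, transpose_comp_map, transpose_whiskerRight_mulHom, transpose_unitHom,
      transpose, MonoidalRightAction.actionHom_leftUnitor]
    simp only [MonoidalRightAction.comp_actionHomLeft, MonoidalLeftAction.unit_actionHomRight,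
      MonoidalLeftAction.leftUnitor_actionHom, Category.assoc, Iso.inv_hom_id_assoc,
      Iso.inv_hom_id, Category.comp_id]
    rw [reassoc_of% h, MonoidalRightAction.inv_hom_actionHomLeft_assoc])

theorem mulHom_right_unitality (x : C) :
    (ρ_ (aR.obj (x ⊙ₗ Dist))).hom =
      aR.obj (x ⊙ₗ Dist) ◁ unitHom C adj ≫ mulHom adj x (𝟙_ C) ≫
        aR.map ((ρ_ x).hom ⊵ₗ Dist) :=
  transpose_injective adj (by
    have h := triangle_right (D := D) x Dist
    rw [← Category.assoc, transpose_comp_map, transpose_whiskerLeft_mulHom, transpose_unitHom,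
      transpose, MonoidalRightAction.actionHom_rightUnitor]
    simp only [MonoidalRightAction.unit_actionHomRight, MonoidalLeftAction.actionHomRight_comp,
      MonoidalLeftAction.rightUnitor_actionHom, Category.assoc, Iso.inv_hom_id_assoc,
      MonoidalLeftAction.actionHomRight_inv_hom, Category.comp_id]
    rw [h, Iso.inv_hom_id, Category.comp_id])

/-- The composite of `act_C` with a right adjoint of `act_D` is a lax monoidal functor. -/
@[reducible]
def laxMonoidal : (actC C Dist ⋙ aR).LaxMonoidal where
  ε := unitMap C adj
  μ := mulMap adj
  μ_natural_left f y := mulHom_naturality_left adj f y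
  μ_natural_right x f := mulHom_naturality_right adj x f
  associativity x y z := mulHom_associativity adj x y z
  left_unitality x := mulHom_left_unitality adj x
  right_unitality x := mulHom_right_unitality adj x

end LaxMonoidal

end BimoduleCategory

/-- A right adjoint of a linear functor is linear. -/
theorem right_adjoint_linear (k : Type w) [Field k] {D : Type u₂} {M : Type u₃}
    [Category.{v} D] [Category.{v} M] [Preadditive D] [Preadditive M] [Linear k D] [Linear k M]
    {F : D ⥤ M} {G : M ⥤ D} (adj : F ⊣ G) [F.Additive] [F.Linear k] : G.Linear k where
  map_smul f r := (adj.homEquiv _ _).symm.injective (by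
    simp [adj.homEquiv_counit])

theorem actionAdjoint_laxMonoidal
    (k : Type w) [Field k] (C : Type u₁) (D : Type u₂) (M : Type u₃)
    -- `C`, `D`, `M` are `k`-linear locally presentable categories
    [Category.{v} C] [Preadditive C] [Linear k C] [IsLocallyPresentable.{v} C]
    [Category.{v} D] [Preadditive D] [Linear k D] [IsLocallyPresentable.{v} D]
    [Category.{v} M] [Preadditive M] [Linear k M] [IsLocallyPresentable.{v} M]
    -- `C` and `D` are monoidal, with `k`-bilinear and separately cocontinuous tensor product
    [MonoidalCategory C] [MonoidalPreadditive C] [MonoidalLinear k C]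
    [∀ x : C, PreservesColimits (tensorLeft x)] [∀ x : C, PreservesColimits (tensorRight x)]
    [MonoidalCategory D] [MonoidalPreadditive D] [MonoidalLinear k D]
    [∀ y : D, PreservesColimits (tensorLeft y)] [∀ y : D, PreservesColimits (tensorRight y)]
    -- `M` is a `k`-linear `(C, D)`-bimodule category
    [MonoidalLeftAction C M] [MonoidalRightAction D M] [BimoduleCategory C D M]
    [IsLinearBimoduleCategory k C D M]
    -- the distinguished object; the action functors on it preserve colimits
    (Dist : M)
    (hC : PreservesColimits (BimoduleCategory.actC C Dist))
    (hD : PreservesColimits (BimoduleCategory.actD D Dist)) :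
    -- `act_D` has a right adjoint
    (BimoduleCategory.actD D Dist).IsLeftAdjoint ∧
    -- and for every right adjoint `aR` of `act_D`:
    ∀ (aR : M ⥤ D) (adj : BimoduleCategory.actD D Dist ⊣ aR),
      -- `aR` is a lax `D`-module functor through `laxModuleMap`
      (∃ R : aR.LaxRightLinear D, ∀ (m : M) (y : D),
        R.μᵣ m y = BimoduleCategory.laxModuleMap adj m y) ∧
      -- `F = aR ∘ act_C` is a `k`-linear functor
      (BimoduleCategory.actC C Dist ⋙ aR).Additive ∧
      (BimoduleCategory.actC C Dist ⋙ aR).Linear k ∧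
      -- and it is lax monoidal through `unitMap` and `mulMap`
      ∃ L : (BimoduleCategory.actC C Dist ⋙ aR).LaxMonoidal,
        L.ε = BimoduleCategory.unitMap C adj ∧
        ∀ x y : C, L.μ x y = BimoduleCategory.mulMap adj x y := by
  have := IsLinearBimoduleCategory.additive_left' (k := k) (C := C) (D := D) Dist
  have := IsLinearBimoduleCategory.linear_left' (k := k) (C := C) (D := D) Dist
  have := IsLinearBimoduleCategory.additive_right' (k := k) (C := C) (D := D) Dist
  have := IsLinearBimoduleCategory.linear_right' (k := k) (C := C) (D := D) Dist
  refine ⟨isLeftAdjoint_of_preservesColimits_of_isLocallyPresentable _, fun aR adj => ?_⟩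
  have := adj.right_adjoint_additive
  have := right_adjoint_linear k adj
  exact ⟨⟨BimoduleCategory.laxRightLinear adj, fun _ _ => rfl⟩, inferInstance, inferInstance,
    BimoduleCategory.laxMonoidal adj, rfl, fun _ _ => rfl⟩
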